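/- Let Ω be a bounded C² domain in ℝ^d (d ≥ 2). Then the first Robin eigenvalue satisfies λ₁^α(Ω) = α · H^{d-1}(∂Ω)/|Ω| + O(α²) as α → 0; in particular the derivative of α ↦ λ₁^α(Ω) at α = 0 equals H^{d-1}(∂Ω)/|Ω|. -/

import Mathlib

open MeasureTheory Metric Filter Asymptotics Real RealInnerProductSpace

noncomputable section

abbrev Eu (d : ℕ) := EuclideanSpace ℝ (Fin d)

/-- The set of Rayleigh quotient values of nonzero Lipschitz test functions for the
Robin problem with boundary parameter `α` on `Ω ⊆ ℝ^d`. -/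
def robinRayleighSet (d : ℕ) (α : ℝ) (Ω : Set (Eu d)) : Set ℝ :=
  { lam : ℝ | ∃ (u : Eu d → ℝ) (K : NNReal),
      LipschitzOnWith K u (closure Ω) ∧
      (∫ x in Ω, (u x) ^ 2) ≠ 0 ∧
      lam = ((∫ x in Ω, ‖fderiv ℝ u x‖ ^ 2)
              + α * ∫ x in frontier Ω, (u x) ^ 2 ∂(μH[(d : ℝ) - 1]))
            / (∫ x in Ω, (u x) ^ 2) }

/-- The first Robin eigenvalue `λ₁^α(Ω)`, defined variationally. -/
def robinEig (d : ℕ) (α : ℝ) (Ω : Set (Eu d)) : ℝ :=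
  sInf (robinRayleighSet d α Ω)

/-- A bounded `C²` domain in `ℝ^d`: a bounded open connected set whose boundary can be
locally flattened by `C²` charts. -/
def IsC2DomainD (d : ℕ) (Ω : Set (Eu d)) : Prop :=
  IsOpen Ω ∧ IsConnected Ω ∧ Bornology.IsBounded Ω ∧
  ∀ x ∈ frontier Ω, ∃ (U V : Set (Eu d)) (φ ψ : Eu d → Eu d) (e : Eu d),
    IsOpen U ∧ x ∈ U ∧ IsOpen V ∧ ‖e‖ = 1 ∧
    ContDiffOn ℝ 2 φ U ∧ ContDiffOn ℝ 2 ψ V ∧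
    φ '' U = V ∧ (∀ y ∈ U, ψ (φ y) = y) ∧
    φ '' (U ∩ Ω) = V ∩ {y : Eu d | 0 < ⟪e, y⟫} ∧
    φ '' (U ∩ frontier Ω) = V ∩ {y : Eu d | ⟪e, y⟫ = 0}

/-- The mean oscillation between `μ` and `ν` of Lipschitz functions is controlled by the
`L¹` norm of their gradient on `Ω`. -/
def OscBound {d : ℕ} (Ω : Set (Eu d)) (μ ν : Measure (Eu d)) : Prop :=
  ∃ C : ENNReal, C ≠ ⊤ ∧ ∀ (f : Eu d → ℝ) (K : NNReal), LipschitzWith K f →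
    ∫⁻ x, ∫⁻ y, ‖f x - f y‖ₑ ∂ν ∂μ ≤ C * ∫⁻ x in Ω, ‖fderiv ℝ f x‖ₑ

section OscBound

variable {d : ℕ} {Ω : Set (Eu d)} {μ μ' ν σ : Measure (Eu d)}

lemma measurable_enorm_sub {f : Eu d → ℝ} (hf : Continuous f) :
    Measurable (fun p : Eu d × Eu d => ‖f p.1 - f p.2‖ₑ) :=
  ((hf.comp continuous_fst).sub (hf.comp continuous_snd)).enorm.measurable

lemma OscBound.symm [SFinite μ] [SFinite ν] (h : OscBound Ω μ ν) : OscBound Ω ν μ := by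
  obtain ⟨C, hC, h⟩ := h
  refine ⟨C, hC, fun f K hf => le_trans (le_of_eq ?_) (h f K hf)⟩
  rw [lintegral_lintegral_swap (measurable_enorm_sub hf.continuous).aemeasurable]
  simp only [← edist_eq_enorm_sub, edist_comm]

lemma OscBound.mono_left {c : ENNReal} (hc : c ≠ ⊤) (hμ : μ' ≤ c • μ) (h : OscBound Ω μ ν) :
    OscBound Ω μ' ν := by
  obtain ⟨C, hC, h⟩ := h
  refine ⟨c * C, ENNReal.mul_ne_top hc hC, fun f K hf => ?_⟩
  calc _ ≤ ∫⁻ x, ∫⁻ y, ‖f x - f y‖ₑ ∂ν ∂(c • μ) := lintegral_mono' hμ le_rfl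
    _ = c * ∫⁻ x, ∫⁻ y, ‖f x - f y‖ₑ ∂ν ∂μ := by rw [lintegral_smul_measure, smul_eq_mul]
    _ ≤ _ := by rw [mul_assoc]; gcongr; exact h f K hf

lemma OscBound.mono_left' (hμ : μ' ≤ μ) (h : OscBound Ω μ ν) : OscBound Ω μ' ν :=
  h.mono_left (c := 1) (by simp) (by simpa using hμ)

lemma OscBound.add_left (h : OscBound Ω μ ν) (h' : OscBound Ω μ' ν) :
    OscBound Ω (μ + μ') ν := by
  obtain ⟨C, hC, h⟩ := h
  obtain ⟨C', hC', h'⟩ := h'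
  refine ⟨C + C', ENNReal.add_ne_top.2 ⟨hC, hC'⟩, fun f K hf => ?_⟩
  rw [lintegral_add_measure, add_mul]
  exact add_le_add (h f K hf) (h' f K hf)

lemma oscBound_zero_left : OscBound Ω 0 ν := ⟨0, by simp, by simp⟩

lemma OscBound.trans [IsFiniteMeasure μ] [IsFiniteMeasure ν] [IsFiniteMeasure σ]
    (hν : ν ≠ 0) (h : OscBound Ω μ ν) (h' : OscBound Ω ν σ) : OscBound Ω μ σ := by
  obtain ⟨C, hC, h⟩ := h
  obtain ⟨C', hC', h'⟩ := h'
  have hν0 : ν Set.univ ≠ 0 := by simpa using hν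
  refine ⟨(ν Set.univ)⁻¹ * (σ Set.univ * C + μ Set.univ * C'), by finiteness, fun f K hf => ?_⟩
  have hm := measurable_enorm_sub hf.continuous
  have key : ν Set.univ * ∫⁻ x, ∫⁻ z, ‖f x - f z‖ₑ ∂σ ∂μ ≤
      σ Set.univ * (∫⁻ x, ∫⁻ y, ‖f x - f y‖ₑ ∂ν ∂μ) +
        μ Set.univ * ∫⁻ y, ∫⁻ z, ‖f y - f z‖ₑ ∂σ ∂ν := by
    calc ν Set.univ * ∫⁻ x, ∫⁻ z, ‖f x - f z‖ₑ ∂σ ∂μ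
        = ∫⁻ x, ∫⁻ _y, ∫⁻ z, ‖f x - f z‖ₑ ∂σ ∂ν ∂μ := by
          rw [← lintegral_const_mul _ hm.lintegral_prod_right']
          simp [mul_comm]
      _ ≤ ∫⁻ x, ∫⁻ y, ∫⁻ z, (‖f x - f y‖ₑ + ‖f y - f z‖ₑ) ∂σ ∂ν ∂μ := by
          gcongr with x y z
          simpa only [edist_eq_enorm_sub] using edist_triangle (f x) (f y) (f z)
      _ = ∫⁻ x, ((σ Set.univ * ∫⁻ y, ‖f x - f y‖ₑ ∂ν) +
            ∫⁻ y, ∫⁻ z, ‖f y - f z‖ₑ ∂σ ∂ν) ∂μ := by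
          congr 1 with x
          have hmx : Measurable fun y => ‖f x - f y‖ₑ := hm.comp measurable_prodMk_left
          rw [← lintegral_const_mul _ hmx, ← lintegral_add_right _ hm.lintegral_prod_right']
          congr 1 with y
          rw [lintegral_add_left measurable_const]
          simp [mul_comm]
      _ = _ := by
          rw [lintegral_add_right _ measurable_const, lintegral_const_mul _
            hm.lintegral_prod_right']
          simp [mul_comm]
  rw [mul_assoc, ← ENNReal.mul_le_iff_le_inv hν0 (measure_ne_top _ _)]
  refine key.trans ?_
  rw [add_mul, mul_assoc, mul_assoc]
  gcongr
  exacts [h f K hf, h' f K hf]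

lemma OscBound.of_coupling [IsFiniteMeasure σ] {X : Type*} [MeasurableSpace X] {m : Measure X}
    {a b : X → Eu d} (ha : Measurable a) (hb : Measurable b) {C : ENNReal} (hC : C ≠ ⊤)
    (hab : ∀ (f : Eu d → ℝ) (K : NNReal), LipschitzWith K f →
      ∫⁻ x, ‖f (a x) - f (b x)‖ₑ ∂m ≤ C * ∫⁻ x in Ω, ‖fderiv ℝ f x‖ₑ)
    (h : OscBound Ω (m.map b) σ) : OscBound Ω (m.map a) σ := by
  obtain ⟨C', hC', h⟩ := h
  refine ⟨σ Set.univ * C + C', by finiteness, fun f K hf => ?_⟩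
  have hm := measurable_enorm_sub hf.continuous
  have h1 := h f K hf
  rw [lintegral_map hm.lintegral_prod_right' hb] at h1
  rw [lintegral_map hm.lintegral_prod_right' ha]
  have hmab : Measurable fun x => ‖f (a x) - f (b x)‖ₑ := hm.comp (ha.prodMk hb)
  calc ∫⁻ x, ∫⁻ z, ‖f (a x) - f z‖ₑ ∂σ ∂m
      ≤ ∫⁻ x, ∫⁻ z, (‖f (a x) - f (b x)‖ₑ + ‖f (b x) - f z‖ₑ) ∂σ ∂m := by
        gcongr with x z
        simpa only [edist_eq_enorm_sub] using edist_triangle (f (a x)) (f (b x)) (f z)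
    _ = σ Set.univ * ∫⁻ x, ‖f (a x) - f (b x)‖ₑ ∂m + ∫⁻ x, ∫⁻ z, ‖f (b x) - f z‖ₑ ∂σ ∂m := by
        rw [← lintegral_const_mul _ hmab, ← lintegral_add_left (hmab.const_mul _)]
        congr 1 with x
        rw [lintegral_add_left measurable_const]
        simp [mul_comm]
    _ ≤ _ := by
        rw [add_mul, mul_assoc]
        gcongr
        exact hab f K hf

end OscBound

lemma LipschitzWith.enorm_sub_le_lintegral_deriv {g : ℝ → ℝ} {K : NNReal} (hg : LipschitzWith K g)
    {a b : ℝ} (hab : a ≤ b) : ‖g b - g a‖ₑ ≤ ∫⁻ t in Set.Ioc a b, ‖deriv g t‖ₑ := by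
  have hac : AbsolutelyContinuousOnInterval g a b :=
    (hg.lipschitzOnWith).absolutelyContinuousOnInterval
  rw [← hac.integral_deriv_eq_sub, intervalIntegral.integral_of_le hab]
  exact enorm_integral_le_lintegral_enorm _

/-- If the curves `Φ x` push `μ × dt` forward to a measure dominated by Lebesgue measure on `Ω`,
then the increments of a Lipschitz function along them are controlled by its gradient. -/
lemma lintegral_enorm_sub_le_of_curves {d : ℕ} {Ω : Set (Eu d)} {X : Type*} [MeasurableSpace X]
    {μ : Measure X} [SFinite μ] {Φ : X → ℝ → Eu d} (hΦ : Measurable (Function.uncurry Φ))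
    {L : NNReal} (hL : ∀ x, LipschitzWith L (Φ x)) {a b : ℝ} (hab : a ≤ b) {C : ENNReal}
    (hC : ∀ g : Eu d → ENNReal, Measurable g →
      ∫⁻ x, (∫⁻ t in Set.Ioc a b, g (Φ x t)) ∂μ ≤ C * ∫⁻ x in Ω, g x)
    {f : Eu d → ℝ} {K : NNReal} (hf : LipschitzWith K f) :
    ∫⁻ x, ‖f (Φ x b) - f (Φ x a)‖ₑ ∂μ ≤ L * C * ∫⁻ x in Ω, ‖fderiv ℝ f x‖ₑ := by
  have hmeas : ∀ g : Eu d → ENNReal, Measurable g →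
      Measurable fun x => ∫⁻ t in Set.Ioc a b, g (Φ x t) := fun g hg =>
    (hg.comp hΦ).lintegral_prod_right'
  have hdiff : ∀ᵐ x ∂μ, ∀ᵐ t ∂(volume.restrict (Set.Ioc a b)), DifferentiableAt ℝ f (Φ x t) := by
    set N : Set (Eu d) := {x | DifferentiableAt ℝ f x}ᶜ
    have hN : MeasurableSet N := (measurableSet_of_differentiableAt ℝ f).compl
    have hN0 : volume N = 0 := hf.ae_differentiableAt
    have hg : Measurable (N.indicator (1 : Eu d → ENNReal)) := measurable_one.indicator hN
    have h0 := hC _ hg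
    rw [lintegral_indicator_one hN, Measure.restrict_apply hN,
      measure_mono_null Set.inter_subset_left hN0, mul_zero, nonpos_iff_eq_zero,
      lintegral_eq_zero_iff (hmeas _ hg)] at h0
    filter_upwards [h0] with x hx
    have hmx : Measurable fun t => N.indicator (1 : Eu d → ENNReal) (Φ x t) :=
      hg.comp (hL x).continuous.measurable
    rw [Pi.zero_apply, lintegral_eq_zero_iff hmx] at hx
    filter_upwards [hx] with t ht
    by_contra hcon
    have : Φ x t ∈ N := hcon
    simp [this] at ht
  calc ∫⁻ x, ‖f (Φ x b) - f (Φ x a)‖ₑ ∂μ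
      ≤ ∫⁻ x, (L * ∫⁻ t in Set.Ioc a b, ‖fderiv ℝ f (Φ x t)‖ₑ) ∂μ := by
        refine lintegral_mono_ae ?_
        filter_upwards [hdiff] with x hx
        refine ((hf.comp (hL x)).enorm_sub_le_lintegral_deriv hab).trans ?_
        rw [← lintegral_const_mul' _ _ ENNReal.coe_ne_top]
        refine lintegral_mono_ae ?_
        filter_upwards [hx, ae_restrict_of_ae (hL x).ae_differentiableAt_real] with t ht ht'
        rw [(ht.hasFDerivAt.comp_hasDerivAt t ht'.hasDerivAt).deriv, mul_comm]
        refine (ContinuousLinearMap.le_opENorm _ _).trans ?_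
        gcongr
        rw [← ofReal_norm, ← ENNReal.ofReal_coe_nnreal]
        exact ENNReal.ofReal_le_ofReal (norm_deriv_le_of_lipschitz (hL x))
    _ = L * ∫⁻ x, (∫⁻ t in Set.Ioc a b, ‖fderiv ℝ f (Φ x t)‖ₑ) ∂μ :=
        lintegral_const_mul' _ _ ENNReal.coe_ne_top
    _ ≤ _ := by
        rw [mul_assoc]
        gcongr
        exact hC _ (measurable_fderiv ℝ f).enorm

lemma exists_volume_eq_smul_hausdorffMeasure (d : ℕ) :
    ∃ c : NNReal, (volume : Measure (Eu d)) = c • μH[(d : ℝ)] := by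
  have : Measure.IsAddHaarMeasure (μH[(d : ℝ)] : Measure (Eu d)) := by
    simpa using MeasureTheory.isAddHaarMeasure_hausdorffMeasure (E := Eu d)
  exact ⟨_, Measure.isAddLeftInvariant_eq_smul _ _⟩

/-- The part of `s`-dimensional Hausdorff measure covered by a Lipschitz chart is dominated by
the push-forward of Hausdorff measure under the chart. -/
lemma LipschitzWith.hausdorffMeasure_restrict_le {X Y : Type*} [EMetricSpace X] [EMetricSpace Y]
    [MeasurableSpace X] [BorelSpace X] [MeasurableSpace Y] [BorelSpace Y] {K : NNReal} {ψ : X → Y}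
    (hψ : LipschitzWith K ψ) {s : ℝ} (hs : 0 ≤ s) {W : Set X} {M : Set Y} (hM : M ⊆ ψ '' W) :
    (μH[s] : Measure Y).restrict M ≤
      ((K : ENNReal) ^ s) • ((μH[s] : Measure X).restrict W).map ψ := by
  refine Measure.le_iff.2 fun A hA => ?_
  rw [Measure.restrict_apply hA, Measure.smul_apply, smul_eq_mul,
    Measure.map_apply hψ.continuous.measurable hA,
    Measure.restrict_apply (hψ.continuous.measurable hA)]
  refine le_trans (measure_mono ?_) (hψ.hausdorffMeasure_image_le hs _)
  rintro y ⟨hy, hyM⟩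
  obtain ⟨w, hw, rfl⟩ := hM hyM
  exact ⟨w, ⟨hy, hw⟩, rfl⟩

lemma LipschitzWith.volume_restrict_le {d : ℕ} {K : NNReal} {ψ : Eu d → Eu d}
    (hψ : LipschitzWith K ψ) {W M : Set (Eu d)} (hM : M ⊆ ψ '' W) :
    volume.restrict M ≤ ((K : ENNReal) ^ (d : ℝ)) • (volume.restrict W).map ψ := by
  obtain ⟨c, hc⟩ := exists_volume_eq_smul_hausdorffMeasure d
  rw [hc, Measure.restrict_smul, Measure.restrict_smul, Measure.map_smul, smul_comm]
  exact Measure.le_iff.2 fun A hA => by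
    simpa only [Measure.smul_apply] using smul_le_smul_of_nonneg_left
      (hψ.hausdorffMeasure_restrict_le (Nat.cast_nonneg d) hM A) (zero_le (a := c))

/-- If `ψ` has a Lipschitz left inverse on `W`, it pushes Lebesgue measure on `W` forward to a
measure dominated by Lebesgue measure. -/
lemma LipschitzWith.map_volume_restrict_le {d : ℕ} {K : NNReal} {φ ψ : Eu d → Eu d}
    (hφ : LipschitzWith K φ) (hψ : Measurable ψ) {W S : Set (Eu d)}
    (hW : ∀ w ∈ W, φ (ψ w) = w) (hS : ∀ w ∈ W, ψ w ∈ S) :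
    (volume.restrict W).map ψ ≤ ((K : ENNReal) ^ (d : ℝ)) • volume.restrict S := by
  obtain ⟨c, hc⟩ := exists_volume_eq_smul_hausdorffMeasure d
  refine Measure.le_iff.2 fun A hA => ?_
  rw [Measure.map_apply hψ hA, Measure.restrict_apply (hψ hA), Measure.smul_apply,
    Measure.restrict_apply hA, hc, Measure.smul_apply, Measure.smul_apply, smul_comm]
  refine smul_le_smul_of_nonneg_left (le_trans (measure_mono ?_)
    (hφ.hausdorffMeasure_image_le (Nat.cast_nonneg d) (A ∩ S))) (zero_le (a := c))
  rintro w ⟨hwA, hw⟩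
  exact ⟨ψ w, ⟨hwA, hS w hw⟩, hW w hw⟩

lemma lintegral_enorm_sub_translate_le {d : ℕ} {Ω W : Set (Eu d)}
    {Kφ Kψ : NNReal} {φ ψ : Eu d → Eu d} (hφ : LipschitzWith Kφ φ) (hψ : LipschitzWith Kψ ψ)
    {v : Eu d}
    (h : ∀ w ∈ W, ∀ t ∈ Set.Ioc (0 : ℝ) 1, φ (ψ (w + t • v)) = w + t • v ∧ ψ (w + t • v) ∈ Ω)
    {f : Eu d → ℝ} {K : NNReal} (hf : LipschitzWith K f) :
    ∫⁻ w in W, ‖f (ψ (w + v)) - f (ψ w)‖ₑ ≤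
      (Kψ * ‖v‖₊ : NNReal) * (Kφ : ENNReal) ^ (d : ℝ) * ∫⁻ x in Ω, ‖fderiv ℝ f x‖ₑ := by
  have hΦ : Continuous (Function.uncurry fun (w : Eu d) (t : ℝ) => ψ (w + t • v)) :=
    hψ.continuous.comp (by fun_prop)
  have := lintegral_enorm_sub_le_of_curves (Ω := Ω) (μ := volume.restrict W)
    (Φ := fun w t => ψ (w + t • v)) hΦ.measurable (L := Kψ * ‖v‖₊) (a := 0) (b := 1)
    (C := (Kφ : ENNReal) ^ (d : ℝ)) ?_ zero_le_one ?_ hf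
  · simpa using this
  · intro w
    refine hψ.comp (LipschitzWith.of_dist_le_mul fun s t => ?_)
    simp [dist_eq_norm, ← sub_smul, norm_smul, mul_comm]
  · intro g hg
    rw [lintegral_lintegral_swap (f := fun w t => g (ψ (w + t • v)))
      (hg.comp hΦ.measurable).aemeasurable]
    calc _ ≤ ∫⁻ t in Set.Ioc (0 : ℝ) 1, ((Kφ : ENNReal) ^ (d : ℝ) * ∫⁻ x in Ω, g x) := by
          refine setLIntegral_mono measurable_const fun t ht => ?_
          have hψt : Measurable fun w => ψ (w + t • v) :=
            hψ.continuous.measurable.comp (measurable_id.add_const _)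
          rw [← smul_eq_mul, ← lintegral_smul_measure, ← lintegral_map hg hψt]
          refine lintegral_mono' (LipschitzWith.map_volume_restrict_le
            (φ := fun x => φ x - t • v) ?_ hψt ?_ ?_) le_rfl
          · simpa using hφ.sub (LipschitzWith.const (t • v))
          · intro w hw
            rw [(h w hw t ht).1, add_sub_cancel_right]
          · exact fun w hw => (h w hw t ht).2
      _ = _ := by simp

lemma oscBound_ball {d : ℕ} {Ω : Set (Eu d)} {x : Eu d} {ρ : ℝ} (h : ball x (3 * ρ) ⊆ Ω) :
    OscBound Ω (volume.restrict (ball x ρ)) (volume.restrict (ball x ρ)) := by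
  refine ⟨volume (ball (0 : Eu d) (2 * ρ)) * ENNReal.ofReal (2 * ρ),
    ENNReal.mul_ne_top measure_ball_lt_top.ne ENNReal.ofReal_ne_top, fun f K hf => ?_⟩
  have hm := measurable_enorm_sub hf.continuous
  calc ∫⁻ z in ball x ρ, ∫⁻ y in ball x ρ, ‖f z - f y‖ₑ
      ≤ ∫⁻ y in ball x ρ, ∫⁻ v in ball (0 : Eu d) (2 * ρ), ‖f (y + v) - f y‖ₑ := by
        refine setLIntegral_mono' measurableSet_ball fun y hy => ?_
        rw [← lintegral_indicator measurableSet_ball, ← lintegral_indicator measurableSet_ball,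
          ← lintegral_add_left_eq_self _ y]
        refine lintegral_mono fun v => ?_
        by_cases hv : y + v ∈ ball x ρ
        swap
        · simp [Set.indicator_of_notMem hv]
        rw [Set.indicator_of_mem hv, Set.indicator_of_mem, ← edist_eq_enorm_sub, ← edist_eq_enorm_sub, edist_comm]
        have : v = (y + v - x) - (y - x) := by abel
        rw [mem_ball_zero_iff, this]
        rw [mem_ball, dist_eq_norm] at hy hv
        linarith [norm_sub_le (y + v - x) (y - x)]
    _ = ∫⁻ v in ball (0 : Eu d) (2 * ρ), ∫⁻ y in ball x ρ, ‖f (y + v) - f y‖ₑ :=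
        lintegral_lintegral_swap (f := fun y v => ‖f (y + v) - f y‖ₑ) (hm.comp ((measurable_fst.add measurable_snd).prodMk
          measurable_fst)).aemeasurable
    _ ≤ ∫⁻ v in ball (0 : Eu d) (2 * ρ),
          (ENNReal.ofReal (2 * ρ) * ∫⁻ x in Ω, ‖fderiv ℝ f x‖ₑ) := by
        refine setLIntegral_mono' measurableSet_ball fun v hv => ?_
        rw [mem_ball_zero_iff] at hv
        refine (lintegral_enorm_sub_translate_le (Ω := Ω) LipschitzWith.id LipschitzWith.id
          (fun y hy t ht => ⟨rfl, h ?_⟩) hf).trans ?_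
        · rw [mem_ball, dist_eq_norm] at hy ⊢
          have h1 : ‖t • v‖ ≤ ‖v‖ := by
            rw [norm_smul, Real.norm_eq_abs, abs_of_pos ht.1]
            exact mul_le_of_le_one_left (norm_nonneg v) ht.2
          have : y + t • v - x = (y - x) + t • v := by abel
          simp only [id, this]
          linarith [norm_add_le (y - x) (t • v)]
        · gcongr
          simp only [one_mul, ENNReal.coe_one, ENNReal.one_rpow, mul_one]
          rw [← ENNReal.ofReal_coe_nnreal, coe_nnnorm]
          exact ENNReal.ofReal_le_ofReal hv.le
    _ = _ := by rw [setLIntegral_const]; ring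

/-- On a connected open set, Lebesgue measure on any compact subset is comparable to Lebesgue
measure on a fixed ball. -/
lemma exists_oscBound_compact {d : ℕ} {Ω : Set (Eu d)} (hΩ : IsOpen Ω) (hc : IsConnected Ω) :
    ∃ (x₀ : Eu d) (r₀ : ℝ), 0 < r₀ ∧ ball x₀ r₀ ⊆ Ω ∧ ∀ M ⊆ Ω, IsCompact M →
      OscBound Ω (volume.restrict M) (volume.restrict (ball x₀ r₀)) := by
  have hball : ∀ x ∈ Ω, ∃ ρ > 0, ball x (3 * ρ) ⊆ Ω := fun x hx => by
    obtain ⟨ε, hε, h⟩ := Metric.isOpen_iff.1 hΩ x hx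
    exact ⟨ε / 3, by positivity, by rwa [mul_div_cancel₀ _ three_ne_zero]⟩
  obtain ⟨x₀, hx₀⟩ := hc.nonempty
  obtain ⟨r₀, hr₀, hx₀r⟩ := hball x₀ hx₀
  have hfin : ∀ (x : Eu d) r, IsFiniteMeasure (volume.restrict (ball x r)) := fun x r =>
    ⟨by simpa using measure_ball_lt_top⟩
  set β := volume.restrict (ball x₀ r₀)
  set u : Set (Eu d) := {x | ∃ r > 0, OscBound Ω (volume.restrict (ball x r)) β}
  have hu : IsOpen u := by
    rw [Metric.isOpen_iff]
    rintro x ⟨r, hr, h⟩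
    refine ⟨r / 2, half_pos hr, fun y hy => ⟨r / 2, half_pos hr, h.mono_left' ?_⟩⟩
    refine Measure.restrict_mono (ball_subset_ball' ?_) le_rfl
    rw [mem_ball] at hy
    linarith
  have hsub : Ω ⊆ u := by
    refine hc.isPreconnected.subset_of_closure_inter_subset hu
      ⟨x₀, hx₀, r₀, hr₀, oscBound_ball hx₀r⟩ ?_
    rintro x ⟨hxu, hxΩ⟩
    obtain ⟨ρ, hρ, hxρ⟩ := hball x hxΩ
    obtain ⟨y, ⟨r, hr, hy⟩, hxy⟩ := Metric.mem_closure_iff.1 hxu ρ hρ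
    refine ⟨ρ, hρ, ?_⟩
    have hne : volume.restrict (ball y r ∩ ball x ρ) ≠ 0 := by
      rw [Ne, Measure.restrict_eq_zero]
      refine ((isOpen_ball.inter isOpen_ball).measure_pos _ ⟨y, mem_ball_self hr, ?_⟩).ne'
      rwa [mem_ball, dist_comm]
    have : IsFiniteMeasure (volume.restrict (ball y r ∩ ball x ρ)) :=
      ⟨by simpa using (measure_mono Set.inter_subset_left).trans_lt measure_ball_lt_top⟩
    refine OscBound.trans hne (OscBound.symm ?_)
      (hy.mono_left' (Measure.restrict_mono Set.inter_subset_left le_rfl))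
    exact (oscBound_ball hxρ).mono_left' (Measure.restrict_mono Set.inter_subset_right le_rfl)
  refine ⟨x₀, r₀, hr₀, fun y hy => hx₀r (ball_subset_ball (by linarith) hy), fun M hM hMc => ?_⟩
  refine hMc.induction_on (p := fun s => OscBound Ω (volume.restrict s) β) ?_ ?_ ?_ ?_
  · simpa using oscBound_zero_left
  · exact fun s t hst h => h.mono_left' (Measure.restrict_mono hst le_rfl)
  · exact fun s t hs ht => (hs.add_left ht).mono_left' (Measure.restrict_union_le s t)
  · intro x hx
    obtain ⟨r, hr, h⟩ := hsub (hM hx)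
    exact ⟨ball x r, mem_nhdsWithin_of_mem_nhds (ball_mem_nhds x hr), h⟩

/-- A `C²` domain is locally flattened near its boundary by bi-Lipschitz maps. -/
lemma IsC2DomainD.exists_lipschitz_chart {d : ℕ} {Ω : Set (Eu d)} (hΩ : IsC2DomainD d Ω)
    {x : Eu d} (hx : x ∈ frontier Ω) :
    ∃ (e : Eu d) (φ ψ : Eu d → Eu d) (Kφ Kψ : NNReal) (r : ℝ), ‖e‖ = 1 ∧ LipschitzWith Kφ φ ∧
      LipschitzWith Kψ ψ ∧ 0 < r ∧ ⟪e, φ x⟫ = 0 ∧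
      (∀ w ∈ ball (φ x) r, φ (ψ w) = w ∧ (0 < ⟪e, w⟫ → ψ w ∈ Ω)) ∧
      ∀ᶠ y in nhds x, ψ (φ y) = y ∧ (y ∈ Ω → 0 < ⟪e, φ y⟫) ∧
        (y ∈ frontier Ω → ⟪e, φ y⟫ = 0) := by
  obtain ⟨U, V, φ, ψ, e, hU, hxU, hV, he, hφ, hψ, hUV, hinv, hΩ', hfr⟩ := hΩ.2.2.2 x hx
  have hφx : φ x ∈ V := hUV ▸ Set.mem_image_of_mem φ hxU
  have hφc : ContDiffAt ℝ 1 φ x := (hφ.contDiffAt (hU.mem_nhds hxU)).of_le one_le_two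
  have hψc : ContDiffAt ℝ 1 ψ (φ x) := (hψ.contDiffAt (hV.mem_nhds hφx)).of_le one_le_two
  obtain ⟨Kφ, sφ, hsφ, hLφ⟩ := hφc.exists_lipschitzOnWith
  obtain ⟨Kψ, sψ, hsψ, hLψ⟩ := hψc.exists_lipschitzOnWith
  obtain ⟨φ', hφ', hEφ⟩ := hLφ.extend_finite_dimension
  obtain ⟨ψ', hψ', hEψ⟩ := hLψ.extend_finite_dimension
  have hx' : φ' x = φ x := (hEφ (mem_of_mem_nhds hsφ)).symm
  have hψx : Tendsto ψ (nhds (φ x)) (nhds x) := by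
    simpa [hinv x hxU] using hψc.continuousAt.tendsto
  have hev : ∀ᶠ w in nhds (φ x), w ∈ V ∧ w ∈ sψ ∧ ψ w ∈ sφ :=
    inter_mem (hV.mem_nhds hφx) (inter_mem hsψ (hψx hsφ))
  obtain ⟨r, hr, hball⟩ := Metric.eventually_nhds_iff_ball.1 hev
  refine ⟨e, φ', ψ', _, _, r, he, hφ', hψ', hr, ?_, ?_, ?_⟩
  · have : φ x ∈ φ '' (U ∩ frontier Ω) := ⟨x, ⟨hxU, hx⟩, rfl⟩
    rw [hfr] at this
    rw [hx']
    exact this.2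
  · rw [hx']
    intro w hw
    obtain ⟨hwV, hwψ, hwφ⟩ := hball w hw
    rw [← hEψ hwψ, ← hEφ hwφ]
    constructor
    · rw [← hUV] at hwV
      obtain ⟨y, hy, rfl⟩ := hwV
      rw [hinv y hy]
    · intro hpos
      have : w ∈ φ '' (U ∩ Ω) := by rw [hΩ']; exact ⟨hwV, hpos⟩
      obtain ⟨y, hy, rfl⟩ := this
      rw [hinv y hy.1]
      exact hy.2
  · filter_upwards [hU.mem_nhds hxU, hsφ, hφc.continuousAt.tendsto hsψ] with y hyU hyφ hyψ
    rw [← hEφ hyφ, ← hEψ hyψ]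
    refine ⟨hinv y hyU, fun hy => ?_, fun hy => ?_⟩
    · have : φ y ∈ φ '' (U ∩ Ω) := ⟨y, ⟨hyU, hy⟩, rfl⟩
      rw [hΩ'] at this
      exact this.2
    · have : φ y ∈ φ '' (U ∩ frontier Ω) := ⟨y, ⟨hyU, hy⟩, rfl⟩
      rw [hfr] at this
      exact this.2

/-- The decomposition of `ℝ^d` into the hyperplane orthogonal to a unit vector and its span. -/
def hyperplaneProdEquiv {d : ℕ} (e : Eu d) (he : ‖e‖ = 1) :
    (((ℝ ∙ e)ᗮ : Submodule ℝ (Eu d)) × ℝ) ≃L[ℝ] Eu d :=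
  LinearEquiv.toContinuousLinearEquiv
    { toFun := fun p => p.1 + p.2 • e
      invFun := fun w => (⟨w - ⟪e, w⟫ • e, by
        rw [Submodule.mem_orthogonal_singleton_iff_inner_right, inner_sub_right, inner_smul_right,
          real_inner_self_eq_norm_sq, he]
        simp⟩, ⟪e, w⟫)
      map_add' := fun p q => by
        simp only [Prod.fst_add, Prod.snd_add, Submodule.coe_add, add_smul]
        abel
      map_smul' := fun c p => by simp [smul_smul]
      left_inv := fun p => by
        have h : ⟪e, (p.1 : Eu d)⟫ = 0 :=
          Submodule.mem_orthogonal_singleton_iff_inner_right.1 p.1.2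
        ext <;> simp [inner_add_right, inner_smul_right, h, he]
      right_inv := fun w => by simp }

lemma hyperplaneProdEquiv_apply {d : ℕ} (e : Eu d) (he : ‖e‖ = 1)
    (p : ((ℝ ∙ e)ᗮ : Submodule ℝ (Eu d)) × ℝ) :
    hyperplaneProdEquiv e he p = p.1 + p.2 • e := rfl

lemma inner_hyperplaneProdEquiv {d : ℕ} (e : Eu d) (he : ‖e‖ = 1)
    (p : ((ℝ ∙ e)ᗮ : Submodule ℝ (Eu d)) × ℝ) :
    ⟪e, hyperplaneProdEquiv e he p⟫ = p.2 :=
  congrArg Prod.snd ((hyperplaneProdEquiv e he).symm_apply_apply p)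

lemma isAddHaarMeasure_hausdorffMeasure_hyperplane {d : ℕ} (e : Eu d) (he : ‖e‖ = 1) :
    Measure.IsAddHaarMeasure
      (μH[(d : ℝ) - 1] : Measure ((ℝ ∙ e)ᗮ : Submodule ℝ (Eu d))) := by
  have h1 := Submodule.finrank_add_finrank_orthogonal (ℝ ∙ e)
  have hne : e ≠ 0 := by
    rintro rfl
    simp at he
  rw [finrank_span_singleton hne, finrank_euclideanSpace_fin] at h1
  have h2 : (d : ℝ) - 1 = (Module.finrank ℝ ((ℝ ∙ e)ᗮ : Submodule ℝ (Eu d)) : ℝ) := by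
    have h3 := congrArg (Nat.cast (R := ℝ)) h1
    push_cast at h3
    linarith
  rw [h2]
  infer_instance

/-- Near a boundary point, Lebesgue measure on the domain and surface measure on its boundary
are both comparable to any measure comparable to Lebesgue measure on compact subsets. -/
lemma IsC2DomainD.oscBound_near_frontier {d : ℕ} (hd : 1 ≤ d) {Ω : Set (Eu d)}
    (hΩ : IsC2DomainD d Ω) {β : Measure (Eu d)} [IsFiniteMeasure β]
    (hβ : ∀ M ⊆ Ω, IsCompact M → OscBound Ω (volume.restrict M) β)
    {x : Eu d} (hx : x ∈ frontier Ω) :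
    ∃ N ∈ nhds x, OscBound Ω (volume.restrict (Ω ∩ N)) β ∧
      OscBound Ω (Measure.restrict μH[(d : ℝ) - 1] (frontier Ω ∩ N)) β ∧
      μH[(d : ℝ) - 1] (frontier Ω ∩ N) < ⊤ := by
  obtain ⟨e, φ, ψ, Kφ, Kψ, r, he, hφ, hψ, hr, hp, hloc, hev⟩ := hΩ.exists_lipschitz_chart hx
  set T := hyperplaneProdEquiv e he with hT
  set q := (T.symm (φ x)).1
  have hq : T (q, 0) = φ x := by
    have : T.symm (φ x) = (q, 0) := Prod.ext rfl hp
    rw [← this, T.apply_symm_apply]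
  have hTmem : T ⁻¹' ball (φ x) r ∈ nhds (q, (0 : ℝ)) :=
    T.continuous.continuousAt.preimage_mem_nhds (by rw [hq]; exact ball_mem_nhds _ hr)
  obtain ⟨ε, hε, hball⟩ := Metric.mem_nhds_iff.1 hTmem
  set δ := ε / 3 with hδ
  have hδ0 : 0 < δ := by positivity
  set D : Set ((ℝ ∙ e)ᗮ : Submodule ℝ (Eu d)) := closedBall q δ
  have hDball : ∀ y ∈ D, ∀ t ∈ Set.Icc 0 (2 * δ), T (y, t) ∈ ball (φ x) r := by
    intro y hy t ht
    refine hball ?_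
    rw [mem_ball, Prod.dist_eq, max_lt_iff]
    constructor
    · exact (mem_closedBall.1 hy).trans_lt (by linarith)
    · rw [Real.dist_eq, sub_zero, abs_of_nonneg ht.1]
      linarith [ht.2]
  have hTΩ : ∀ y ∈ D, ∀ t ∈ Set.Ioc 0 (2 * δ), φ (ψ (T (y, t))) = T (y, t) ∧ ψ (T (y, t)) ∈ Ω := by
    intro y hy t ht
    obtain ⟨h1, h2⟩ := hloc _ (hDball y hy t ⟨ht.1.le, ht.2⟩)
    refine ⟨h1, h2 ?_⟩
    rw [hT, inner_hyperplaneProdEquiv]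
    exact ht.1
  have hTadd : ∀ y s t, T (y, s) + t • e = T (y, s + t) := by
    intro y s t
    simp only [hT, hyperplaneProdEquiv_apply, add_smul, add_assoc]
  set B : Set (((ℝ ∙ e)ᗮ : Submodule ℝ (Eu d)) × ℝ) := D ×ˢ Set.Ioc 0 δ
  set W : Set (Eu d) := T '' B
  have hBmeas : MeasurableSet B := isClosed_closedBall.measurableSet.prod measurableSet_Ioc
  have hTW : T ⁻¹' W = B := Set.preimage_image_eq _ T.injective
  have hWmeas : MeasurableSet W := by
    have : W = T.symm ⁻¹' B := T.image_eq_preimage_symm B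
    rw [this]
    exact T.symm.continuous.measurable hBmeas
  -- the layer far from the boundary
  have hfar : OscBound Ω ((volume.restrict W).map fun w => ψ (w + δ • e)) β := by
    set M : Set (Eu d) := (fun z => ψ (T z)) '' (D ×ˢ Set.Icc δ (2 * δ))
    have hM : IsCompact M := ((isCompact_closedBall q δ).prod isCompact_Icc).image
      (hψ.continuous.comp T.continuous)
    have hMΩ : M ⊆ Ω := by
      rintro _ ⟨⟨y, t⟩, ⟨hy, ht⟩, rfl⟩
      exact (hTΩ y hy t ⟨hδ0.trans_le ht.1, ht.2⟩).2
    refine (hβ M hMΩ hM).mono_left (c := (Kφ : ENNReal) ^ (d : ℝ)) (by finiteness)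
      (LipschitzWith.map_volume_restrict_le (φ := fun z => φ z - δ • e) ?_
        (hψ.continuous.measurable.comp (measurable_id.add_const _)) ?_ ?_)
    · simpa using hφ.sub (LipschitzWith.const (δ • e))
    · rintro _ ⟨⟨y, s⟩, ⟨hy, hs⟩, rfl⟩
      change φ (ψ (T (y, s) + δ • e)) - δ • e = T (y, s)
      rw [hTadd, (hTΩ y hy (s + δ) ⟨by linarith [hs.1], by linarith [hs.2]⟩).1, ← hTadd,
        add_sub_cancel_right]
    · rintro _ ⟨⟨y, s⟩, ⟨hy, hs⟩, rfl⟩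
      change ψ (T (y, s) + δ • e) ∈ M
      rw [hTadd]
      exact ⟨(y, s + δ), ⟨hy, by linarith [hs.1], by linarith [hs.2]⟩, rfl⟩
  -- the layer at the boundary
  have hnear : OscBound Ω ((volume.restrict W).map ψ) β := by
    refine OscBound.of_coupling hψ.continuous.measurable
      (hψ.continuous.measurable.comp (measurable_id.add_const _))
      (C := (Kψ * ‖δ • e‖₊ : NNReal) * (Kφ : ENNReal) ^ (d : ℝ)) (by finiteness) ?_ hfar
    intro f K hf
    refine le_trans (le_of_eq ?_)
      (lintegral_enorm_sub_translate_le (Ω := Ω) (W := W) hφ hψ (v := δ • e) ?_ hf)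
    · simp only [← edist_eq_enorm_sub, edist_comm, Function.comp_apply, id]
    · rintro _ ⟨⟨y, s⟩, ⟨hy, hs⟩, rfl⟩ t ht
      rw [smul_smul, hTadd]
      have h1 : 0 < t * δ := mul_pos ht.1 hδ0
      have h2 : t * δ ≤ δ := mul_le_of_le_one_left hδ0.le ht.2
      exact hTΩ y hy _ ⟨by linarith [hs.1], by linarith [hs.2]⟩
  -- the boundary itself
  have hHaar := isAddHaarMeasure_hausdorffMeasure_hyperplane e he
  set ν : Measure ((ℝ ∙ e)ᗮ : Submodule ℝ (Eu d)) := μH[(d : ℝ) - 1]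
  set m := (ν.restrict D).prod (volume.restrict (Set.Ioc 0 δ)) with hm
  have hνD : ν D < ⊤ := (isCompact_closedBall q δ).measure_lt_top
  have hνfin : IsFiniteMeasure (ν.restrict D) := ⟨by simpa using hνD⟩
  have hψT : Continuous fun z => ψ (T z) := hψ.continuous.comp T.continuous
  obtain ⟨c, hc⟩ : ∃ c : NNReal, m.map (fun z => ψ (T z)) = c • (volume.restrict W).map ψ := by
    have hmap : (ν.prod volume).map T = Measure.addHaarScalarFactor ((ν.prod volume).map T) volume
        • (volume : Measure (Eu d)) := by
      have : ((ν.prod volume).map T).IsAddHaarMeasure :=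
        T.isAddHaarMeasure_map _
      exact Measure.isAddLeftInvariant_eq_smul _ _
    refine ⟨Measure.addHaarScalarFactor ((ν.prod volume).map T) volume, ?_⟩
    rw [hm, Measure.prod_restrict, ← Measure.map_smul, ← Measure.restrict_smul, ← hmap,
      Measure.restrict_map T.continuous.measurable hWmeas, hTW,
      Measure.map_map hψ.continuous.measurable T.continuous.measurable]
    rfl
  have hflat : OscBound Ω (m.map fun z => ψ (T (z.1, 0))) β := by
    have hpush : ∀ g : Eu d → ENNReal, Measurable g →
        ∫⁻ y in D, (∫⁻ t in Set.Ioc 0 δ, g (ψ (T (y, t)))) ∂ν ≤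
          (c * (Kφ : ENNReal) ^ (d : ℝ)) * ∫⁻ x in Ω, g x := by
      intro g hg
      rw [← lintegral_prod (fun z => g (ψ (T z))) (hg.comp hψT.measurable).aemeasurable, ← hm,
        ← lintegral_map hg hψT.measurable, hc, lintegral_smul_measure, mul_assoc, ENNReal.smul_def,
        smul_eq_mul]
      gcongr
      rw [← smul_eq_mul, ← lintegral_smul_measure]
      refine lintegral_mono' (hφ.map_volume_restrict_le hψ.continuous.measurable ?_ ?_) le_rfl
      all_goals
        rintro _ ⟨⟨y, s⟩, ⟨hy, hs⟩, rfl⟩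
        have := hTΩ y hy s ⟨hs.1, by linarith [hs.2]⟩
        first | exact this.1 | exact this.2
    refine OscBound.of_coupling (b := fun z => ψ (T z))
      (C := ENNReal.ofReal δ * ((Kψ : ENNReal) * (c * (Kφ : ENNReal) ^ (d : ℝ))))
      (hψT.comp (by fun_prop : Continuous
        fun z : ((ℝ ∙ e)ᗮ : Submodule ℝ (Eu d)) × ℝ => (z.1, (0 : ℝ)))).measurable
      hψT.measurable (by finiteness) ?_ ?_
    · intro f K hf
      have hcont : Continuous fun z : ((ℝ ∙ e)ᗮ : Submodule ℝ (Eu d)) × ℝ =>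
          ‖f (ψ (T (z.1, 0))) - f (ψ (T z))‖ₑ :=
        ((hf.continuous.comp (hψT.comp (by fun_prop))).sub (hf.continuous.comp hψT)).enorm
      rw [hm, lintegral_prod_symm _ hcont.measurable.aemeasurable]
      calc _ ≤ ∫⁻ s in Set.Ioc 0 δ, ((Kψ : ENNReal) * (c * (Kφ : ENNReal) ^ (d : ℝ)) *
              ∫⁻ x in Ω, ‖fderiv ℝ f x‖ₑ) := by
            refine setLIntegral_mono measurable_const fun s hs => ?_
            have hcurve := lintegral_enorm_sub_le_of_curves (Ω := Ω) (μ := ν.restrict D)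
              (a := 0) (b := s) (Φ := fun y t => ψ (T (y, t))) (L := Kψ)
              (C := c * (Kφ : ENNReal) ^ (d : ℝ)) hψT.measurable ?_ hs.1.le ?_ hf
            · simpa only [← edist_eq_enorm_sub, edist_comm] using hcurve
            · intro y
              rw [← mul_one Kψ]
              refine hψ.comp (LipschitzWith.of_dist_le_mul fun s t => ?_)
              simp [hT, hyperplaneProdEquiv_apply, dist_eq_norm, ← sub_smul, norm_smul, he]
            · intro g hg
              refine le_trans ?_ (hpush g hg)
              gcongr
              exact hs.2
        _ = _ := by
            rw [setLIntegral_const, Real.volume_Ioc, sub_zero]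
            ring
    · rw [hc]
      exact hnear.mono_left (c := c) (by finiteness) le_rfl
  have hcoe : LipschitzWith Kψ fun y : ((ℝ ∙ e)ᗮ : Submodule ℝ (Eu d)) => ψ (T (y, 0)) := by
    rw [← mul_one Kψ]
    refine hψ.comp (LipschitzWith.of_dist_le_mul fun y z => ?_)
    simp [hT, hyperplaneProdEquiv_apply, Subtype.dist_eq]
  have hmap_fst : m.map (fun z => ψ (T (z.1, 0))) =
      ENNReal.ofReal δ • (ν.restrict D).map fun y => ψ (T (y, 0)) := by
    have : (fun z : ((ℝ ∙ e)ᗮ : Submodule ℝ (Eu d)) × ℝ => ψ (T (z.1, 0))) =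
        (fun y => ψ (T (y, 0))) ∘ Prod.fst := rfl
    rw [this, ← Measure.map_map hcoe.continuous.measurable measurable_fst, hm,
      Measure.map_fst_prod, Measure.map_smul]
    simp
  set N : Set (Eu d) := {y | ψ (φ y) = y ∧ (y ∈ Ω → 0 < ⟪e, φ y⟫) ∧
    (y ∈ frontier Ω → ⟪e, φ y⟫ = 0)} ∩ {y | T.symm (φ y) ∈ ball q δ ×ˢ Set.Ioo (-δ) δ}
  have hN : N ∈ nhds x := by
    refine inter_mem hev ?_
    have hcont : Continuous fun y => T.symm (φ y) := T.symm.continuous.comp hφ.continuous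
    refine hcont.continuousAt.preimage_mem_nhds ?_
    have : T.symm (φ x) = (q, 0) := Prod.ext rfl hp
    rw [this]
    exact prod_mem_nhds (ball_mem_nhds q hδ0) (Ioo_mem_nhds (by linarith) hδ0)
  have hsurf : Measure.restrict μH[(d : ℝ) - 1] (frontier Ω ∩ N) ≤
      ((Kψ : ENNReal) ^ ((d : ℝ) - 1)) • (ν.restrict D).map fun y => ψ (T (y, 0)) := by
    refine hcoe.hausdorffMeasure_restrict_le ?_ ?_
    · rw [sub_nonneg]
      exact_mod_cast hd
    · rintro y ⟨hy, ⟨hy1, -, hy2⟩, hy3⟩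
      refine ⟨(T.symm (φ y)).1, ball_subset_closedBall hy3.1, ?_⟩
      have : T.symm (φ y) = ((T.symm (φ y)).1, 0) := Prod.ext rfl (hy2 hy)
      simp only [← this, T.apply_symm_apply, hy1]
  have hKtop : (Kψ : ENNReal) ^ ((d : ℝ) - 1) ≠ ⊤ :=
    ENNReal.rpow_ne_top_of_nonneg (by rw [sub_nonneg]; exact_mod_cast hd) ENNReal.coe_ne_top
  refine ⟨N, hN, hnear.mono_left (c := (Kψ : ENNReal) ^ (d : ℝ)) (by finiteness)
    (hψ.volume_restrict_le ?_), ?_, ?_⟩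
  · rintro y ⟨hy, ⟨hy1, hy2, -⟩, hy3⟩
    refine ⟨φ y, ⟨T.symm (φ y), ⟨ball_subset_closedBall hy3.1, hy2 hy, hy3.2.2.le⟩, ?_⟩, hy1⟩
    exact T.apply_symm_apply _
  · refine hflat.mono_left (c := (Kψ : ENNReal) ^ ((d : ℝ) - 1) * (ENNReal.ofReal δ)⁻¹)
      (ENNReal.mul_ne_top hKtop (by simpa using hδ0)) ?_
    rw [hmap_fst, smul_smul, mul_assoc, ENNReal.inv_mul_cancel (by simpa using hδ0)
      ENNReal.ofReal_ne_top, mul_one]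
    exact hsurf
  · calc _ = Measure.restrict μH[(d : ℝ) - 1] (frontier Ω ∩ N) Set.univ := by simp
      _ ≤ _ := hsurf _
      _ = (Kψ : ENNReal) ^ ((d : ℝ) - 1) * ν D := by
        rw [Measure.smul_apply, Measure.map_apply hcoe.continuous.measurable MeasurableSet.univ]
        simp
      _ < ⊤ := ENNReal.mul_lt_top hKtop.lt_top hνD

/-- On a bounded `C²` domain the surface measure is finite and comparable to Lebesgue measure. -/
lemma IsC2DomainD.oscBound_frontier {d : ℕ} (hd : 1 ≤ d) {Ω : Set (Eu d)} (hΩ : IsC2DomainD d Ω) :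
    μH[(d : ℝ) - 1] (frontier Ω) < ⊤ ∧
      OscBound Ω (Measure.restrict μH[(d : ℝ) - 1] (frontier Ω)) (volume.restrict Ω) := by
  obtain ⟨hopen, hconn, hbdd, -⟩ := id hΩ
  obtain ⟨x₀, r₀, hr₀, hball, hK⟩ := exists_oscBound_compact hopen hconn
  have hβfin : IsFiniteMeasure (volume.restrict (ball x₀ r₀)) :=
    ⟨by simpa using measure_ball_lt_top⟩
  have hβ0 : volume.restrict (ball x₀ r₀) ≠ 0 := by
    rw [Ne, Measure.restrict_eq_zero]
    exact (measure_ball_pos _ _ hr₀).ne'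
  have key : OscBound Ω (volume.restrict (Ω ∩ closure Ω)) (volume.restrict (ball x₀ r₀)) ∧
      OscBound Ω (Measure.restrict μH[(d : ℝ) - 1] (frontier Ω ∩ closure Ω))
        (volume.restrict (ball x₀ r₀)) ∧ μH[(d : ℝ) - 1] (frontier Ω ∩ closure Ω) < ⊤ := by
    refine hbdd.isCompact_closure.induction_on
      (p := fun s => OscBound Ω (volume.restrict (Ω ∩ s)) (volume.restrict (ball x₀ r₀)) ∧
        OscBound Ω (Measure.restrict μH[(d : ℝ) - 1] (frontier Ω ∩ s))
          (volume.restrict (ball x₀ r₀)) ∧ μH[(d : ℝ) - 1] (frontier Ω ∩ s) < ⊤) ?_ ?_ ?_ ?_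
    · simp [oscBound_zero_left]
    · rintro s t hst ⟨h1, h2, h3⟩
      exact ⟨h1.mono_left' (Measure.restrict_mono (Set.inter_subset_inter_right _ hst) le_rfl),
        h2.mono_left' (Measure.restrict_mono (Set.inter_subset_inter_right _ hst) le_rfl),
        (measure_mono (Set.inter_subset_inter_right _ hst)).trans_lt h3⟩
    · rintro s t ⟨h1, h2, h3⟩ ⟨h1', h2', h3'⟩
      rw [Set.inter_union_distrib_left, Set.inter_union_distrib_left]
      exact ⟨(h1.add_left h1').mono_left' (Measure.restrict_union_le _ _),
        (h2.add_left h2').mono_left' (Measure.restrict_union_le _ _),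
        (measure_union_le _ _).trans_lt (ENNReal.add_lt_top.2 ⟨h3, h3'⟩)⟩
    · intro x hx
      by_cases hxΩ : x ∈ Ω
      · obtain ⟨ε, hε, hxε⟩ := Metric.nhds_basis_closedBall.mem_iff.1 (hopen.mem_nhds hxΩ)
        refine ⟨closedBall x ε, mem_nhdsWithin_of_mem_nhds (closedBall_mem_nhds x hε), ?_⟩
        have hempty : frontier Ω ∩ closedBall x ε = ∅ := by
          rw [← Set.disjoint_iff_inter_eq_empty]
          exact (hopen.frontier_eq ▸ Set.disjoint_sdiff_left).mono_right hxε
        rw [Set.inter_eq_right.2 hxε, hempty]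
        exact ⟨hK _ hxε (isCompact_closedBall x ε), by simp [oscBound_zero_left], by simp⟩
      · have hxf : x ∈ frontier Ω := by
          rw [hopen.frontier_eq]
          exact ⟨hx, hxΩ⟩
        obtain ⟨N, hN, h⟩ := hΩ.oscBound_near_frontier hd hK hxf
        exact ⟨N, mem_nhdsWithin_of_mem_nhds hN, h⟩
  rw [Set.inter_eq_left.2 subset_closure, Set.inter_eq_left.2 frontier_subset_closure] at key
  obtain ⟨h1, h2, h3⟩ := key
  have : IsFiniteMeasure (volume.restrict Ω) := ⟨by simpa using hbdd.measure_lt_top⟩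
  have : IsFiniteMeasure (Measure.restrict μH[(d : ℝ) - 1] (frontier Ω)) := ⟨by simpa using h3⟩
  exact ⟨h3, h2.trans hβ0 h1.symm⟩

lemma enorm_mul_integral_sub_le {d : ℕ} {μ ν : Measure (Eu d)} [IsFiniteMeasure μ]
    [IsFiniteMeasure ν] {f : Eu d → ℝ} (hμ : Integrable f μ) (hν : Integrable f ν) :
    ‖ν.real Set.univ * ∫ x, f x ∂μ - μ.real Set.univ * ∫ x, f x ∂ν‖ₑ ≤
      ∫⁻ x, ∫⁻ y, ‖f x - f y‖ₑ ∂ν ∂μ := by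
  have h : ν.real Set.univ * ∫ x, f x ∂μ - μ.real Set.univ * ∫ x, f x ∂ν =
      ∫ x, ∫ y, (f x - f y) ∂ν ∂μ := by
    have h1 : ∀ x, ∫ y, (f x - f y) ∂ν = ν.real Set.univ * f x - ∫ y, f y ∂ν := fun x => by
      rw [integral_sub (integrable_const _) hν, integral_const, smul_eq_mul]
    simp_rw [h1]
    rw [integral_sub (hμ.const_mul _) (integrable_const _), integral_const_mul, integral_const,
      smul_eq_mul]
  rw [h]
  refine (enorm_integral_le_lintegral_enorm _).trans ?_
  gcongr with x
  exact enorm_integral_le_lintegral_enorm _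

lemma Bornology.IsBounded.integrable_restrict_of_continuous {d : ℕ} {Ω M : Set (Eu d)}
    (hΩ : Bornology.IsBounded Ω) (hM : MeasurableSet M) (hMΩ : M ⊆ closure Ω)
    {μ : Measure (Eu d)} (hμ : μ M < ⊤) {f : Eu d → ℝ} (hf : Continuous f) :
    IntegrableOn f M μ := by
  obtain ⟨c, hc⟩ := hΩ.isCompact_closure.exists_bound_of_continuousOn hf.continuousOn
  exact IntegrableOn.of_bound hμ hf.aestronglyMeasurable c
    (ae_restrict_of_forall_mem hM fun x hx => hc x (hMΩ hx))

lemma LipschitzWith.integrable_norm_fderiv_sq {d : ℕ} {Ω : Set (Eu d)} (hΩ : volume Ω < ⊤)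
    {u : Eu d → ℝ} {K : NNReal} (hu : LipschitzWith K u) :
    IntegrableOn (fun x => ‖fderiv ℝ u x‖ ^ 2) Ω := by
  refine IntegrableOn.of_bound hΩ
    ((measurable_fderiv ℝ u).norm.pow_const 2).aestronglyMeasurable ((K : ℝ) ^ 2)
    (Eventually.of_forall fun x => ?_)
  rw [Real.norm_eq_abs, abs_of_nonneg (by positivity)]
  gcongr
  exact norm_fderiv_le_of_lipschitz ℝ hu

/-- The `L¹` trace inequality for squares: boundary and interior averages of `u²` differ by at
most the `L¹` norm of the gradient of `u²`. -/
lemma IsC2DomainD.exists_trace_bound {d : ℕ} (hd : 1 ≤ d) {Ω : Set (Eu d)}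
    (hΩ : IsC2DomainD d Ω) :
    ∃ C : ℝ, 0 ≤ C ∧ ∀ (u : Eu d → ℝ) (K : NNReal), LipschitzWith K u →
      |(∫ x in frontier Ω, u x ^ 2 ∂(μH[(d : ℝ) - 1])) -
        (μH[(d : ℝ) - 1] (frontier Ω)).toReal / (volume Ω).toReal * ∫ x in Ω, u x ^ 2| ≤
      C * ∫ x in Ω, 2 * |u x| * ‖fderiv ℝ u x‖ := by
  obtain ⟨hS, C, hC, hosc⟩ := hΩ.oscBound_frontier hd
  obtain ⟨hopen, hconn, hbdd, -⟩ := hΩ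
  have hV : volume Ω < ⊤ := hbdd.measure_lt_top
  have hV0 : 0 < (volume Ω).toReal :=
    ENNReal.toReal_pos (hopen.measure_pos _ hconn.nonempty).ne' hV.ne
  refine ⟨C.toReal / (volume Ω).toReal, by positivity, fun u K hu => ?_⟩
  obtain ⟨M, hM⟩ := hbdd.isCompact_closure.exists_bound_of_continuousOn hu.continuous.continuousOn
  have hM0 : 0 ≤ M := (norm_nonneg _).trans (hM _ (subset_closure hconn.nonempty.some_mem))
  have hu2 : LipschitzOnWith (2 * M.toNNReal * K) (fun x => u x ^ 2) (closure Ω) := by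
    refine LipschitzOnWith.of_dist_le_mul fun x hx y hy => ?_
    rw [Real.dist_eq, show u x ^ 2 - u y ^ 2 = (u x + u y) * (u x - u y) by ring, abs_mul]
    push_cast
    rw [Real.coe_toNNReal M hM0, mul_assoc]
    have h1 : |u x - u y| ≤ K * dist x y := hu.dist_le_mul x y
    have h2 : |u x + u y| ≤ 2 * M := by
      have := abs_add_le (u x) (u y)
      have := hM x hx
      have := hM y hy
      simp only [Real.norm_eq_abs] at *
      linarith
    gcongr
  obtain ⟨f, hf, hfu⟩ := hu2.extend_real
  have hfin : IsFiniteMeasure (volume.restrict Ω) := ⟨by simpa using hV⟩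
  have hfinS : IsFiniteMeasure (Measure.restrict μH[(d : ℝ) - 1] (frontier Ω)) :=
    ⟨by simpa using hS⟩
  have hosc' := (enorm_mul_integral_sub_le
    (hbdd.integrable_restrict_of_continuous isClosed_frontier.measurableSet
      frontier_subset_closure hS hf.continuous)
    (hbdd.integrable_restrict_of_continuous hopen.measurableSet subset_closure hV
      hf.continuous)).trans (hosc f _ hf)
  have hfB : ∫ x in frontier Ω, f x ∂(μH[(d : ℝ) - 1]) =
      ∫ x in frontier Ω, u x ^ 2 ∂(μH[(d : ℝ) - 1]) :=
    setIntegral_congr_fun isClosed_frontier.measurableSet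
      fun x hx => (hfu (frontier_subset_closure hx)).symm
  have hfU : ∫ x in Ω, f x = ∫ x in Ω, u x ^ 2 :=
    setIntegral_congr_fun hopen.measurableSet fun x hx => (hfu (subset_closure hx)).symm
  have hgrad : ∀ᵐ x ∂(volume.restrict Ω), ‖fderiv ℝ f x‖ = 2 * |u x| * ‖fderiv ℝ u x‖ := by
    filter_upwards [ae_restrict_mem hopen.measurableSet,
      ae_restrict_of_ae hu.ae_differentiableAt] with x hx hux
    have heq : f =ᶠ[nhds x] fun y => u y ^ 2 := by
      filter_upwards [hopen.mem_nhds hx] with y hy using (hfu (subset_closure hy)).symm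
    rw [heq.fderiv_eq, (hux.hasFDerivAt.pow 2).fderiv, norm_smul]
    simp
  have hG : ∫⁻ x in Ω, ‖fderiv ℝ f x‖ₑ =
      ENNReal.ofReal (∫ x in Ω, 2 * |u x| * ‖fderiv ℝ u x‖) := by
    rw [← integral_congr_ae hgrad, ofReal_integral_norm_eq_lintegral_enorm]
    exact IntegrableOn.of_bound hV (measurable_fderiv ℝ f).aestronglyMeasurable _
      (Eventually.of_forall fun x => norm_fderiv_le_of_lipschitz ℝ hf)
  rw [hfB, hfU, hG, measureReal_restrict_apply_univ, measureReal_restrict_apply_univ,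
    ← ENNReal.ofReal_toReal hC, ← ENNReal.ofReal_mul ENNReal.toReal_nonneg, Real.enorm_eq_ofReal_abs,
    ENNReal.ofReal_le_ofReal_iff (by positivity)] at hosc'
  rw [div_mul_eq_mul_div C.toReal, le_div_iff₀ hV0]
  refine le_trans (le_of_eq ?_) hosc'
  rw [Measure.real, Measure.real]
  conv_lhs => rhs; rw [← abs_of_pos hV0]
  rw [← abs_mul]
  congr 1
  field_simp

lemma robinRayleighSet_lower_bound {d : ℕ} (hd : 1 ≤ d) {Ω : Set (Eu d)}
    (hΩ : IsC2DomainD d Ω) :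
    ∃ C : ℝ, ∀ α : ℝ, ∀ lam ∈ robinRayleighSet d α Ω,
      α * (μH[(d : ℝ) - 1] (frontier Ω)).toReal / (volume Ω).toReal - C * α ^ 2 ≤ lam := by
  obtain ⟨C, hC, htrace⟩ := hΩ.exists_trace_bound hd
  obtain ⟨hopen, hconn, hbdd, -⟩ := hΩ
  refine ⟨C ^ 2, ?_⟩
  rintro α _ ⟨u, K, hu, hU0, rfl⟩
  obtain ⟨v, hv, huv⟩ := hu.extend_real
  have hvU : ∫ x in Ω, u x ^ 2 = ∫ x in Ω, v x ^ 2 :=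
    setIntegral_congr_fun hopen.measurableSet fun x hx => by simp only [huv (subset_closure hx)]
  have hvB : ∫ x in frontier Ω, u x ^ 2 ∂(μH[(d : ℝ) - 1]) =
      ∫ x in frontier Ω, v x ^ 2 ∂(μH[(d : ℝ) - 1]) :=
    setIntegral_congr_fun isClosed_frontier.measurableSet
      fun x hx => by simp only [huv (frontier_subset_closure hx)]
  have hvG : ∫ x in Ω, ‖fderiv ℝ u x‖ ^ 2 = ∫ x in Ω, ‖fderiv ℝ v x‖ ^ 2 := by
    refine setIntegral_congr_fun hopen.measurableSet fun x hx => ?_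
    have heq : u =ᶠ[nhds x] v := by
      filter_upwards [hopen.mem_nhds hx] with y hy using huv (subset_closure hy)
    simp only [heq.fderiv_eq]
  rw [hvU] at hU0
  rw [hvU, hvB, hvG]
  have hUpos : 0 < ∫ x in Ω, v x ^ 2 :=
    lt_of_le_of_ne (integral_nonneg fun x => sq_nonneg _) hU0.symm
  have hV : volume Ω < ⊤ := hbdd.measure_lt_top
  have hiU : IntegrableOn (fun x => v x ^ 2) Ω := hbdd.integrable_restrict_of_continuous
    hopen.measurableSet subset_closure hV (hv.continuous.pow 2)
  have hiG := hv.integrable_norm_fderiv_sq hV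
  have hyoung : |α| * (C * ∫ x in Ω, 2 * |v x| * ‖fderiv ℝ v x‖) ≤
      (∫ x in Ω, ‖fderiv ℝ v x‖ ^ 2) + C ^ 2 * α ^ 2 * ∫ x in Ω, v x ^ 2 := by
    rw [← integral_const_mul, ← integral_const_mul, ← integral_const_mul,
      ← integral_add hiG (hiU.const_mul _)]
    refine integral_mono_of_nonneg (Eventually.of_forall fun x => by positivity)
      (hiG.add (hiU.const_mul _)) (Eventually.of_forall fun x => ?_)
    simp only
    rw [← sq_abs α, ← sq_abs (v x)]
    nlinarith [sq_nonneg (‖fderiv ℝ v x‖ - C * |α| * |v x|)]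
  have ht := mul_le_mul_of_nonneg_left (htrace v K hv) (abs_nonneg α)
  rw [← abs_mul] at ht
  have hlow := (abs_le.1 (ht.trans hyoung)).1
  rw [le_div_iff₀ hUpos, mul_div_assoc]
  nlinarith [hlow]

lemma mem_robinRayleighSet_const {d : ℕ} {Ω : Set (Eu d)} (hV : (volume Ω).toReal ≠ 0) (α : ℝ) :
    α * (μH[(d : ℝ) - 1] (frontier Ω)).toReal / (volume Ω).toReal ∈ robinRayleighSet d α Ω := by
  refine ⟨fun _ => 1, 0, (LipschitzWith.const 1).lipschitzOnWith, ?_, ?_⟩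
  · simpa [Measure.real] using hV
  · simp [Measure.real]

theorem robin_eigenvalue_derivative_at_zero
    (d : ℕ) (hd : 2 ≤ d) (Ω : Set (Eu d)) (hΩ : IsC2DomainD d Ω) :
    ((fun α : ℝ =>
        robinEig d α Ω - α * (μH[(d : ℝ) - 1] (frontier Ω)).toReal / (volume Ω).toReal)
      =O[nhds (0 : ℝ)] (fun α : ℝ => α ^ 2)) ∧
    HasDerivAt (fun α : ℝ => robinEig d α Ω)
      ((μH[(d : ℝ) - 1] (frontier Ω)).toReal / (volume Ω).toReal) 0 := by
  have hV : (volume Ω).toReal ≠ 0 := (ENNReal.toReal_pos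
    (hΩ.1.measure_pos _ hΩ.2.1.nonempty).ne' hΩ.2.2.1.measure_lt_top.ne).ne'
  obtain ⟨C, hC⟩ := robinRayleighSet_lower_bound (one_le_two.trans hd) hΩ
  have hupper : ∀ α, robinEig d α Ω ≤
      α * (μH[(d : ℝ) - 1] (frontier Ω)).toReal / (volume Ω).toReal := fun α =>
    csInf_le ⟨_, hC α⟩ (mem_robinRayleighSet_const hV α)
  have hlower : ∀ α, α * (μH[(d : ℝ) - 1] (frontier Ω)).toReal / (volume Ω).toReal - C * α ^ 2 ≤
      robinEig d α Ω := fun α => le_csInf ⟨_, mem_robinRayleighSet_const hV α⟩ (hC α)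
  have hO : (fun α : ℝ =>
      robinEig d α Ω - α * (μH[(d : ℝ) - 1] (frontier Ω)).toReal / (volume Ω).toReal)
      =O[nhds (0 : ℝ)] (fun α : ℝ => α ^ 2) := by
    refine IsBigO.of_bound C (Eventually.of_forall fun α => ?_)
    rw [Real.norm_eq_abs, Real.norm_eq_abs, abs_of_nonneg (sq_nonneg α), abs_le]
    constructor <;> linarith [hupper α, hlower α]
  refine ⟨hO, ?_⟩
  have h0 : robinEig d 0 Ω = 0 :=
    le_antisymm (by simpa using hupper 0) (by simpa using hlower 0)
  rw [hasDerivAt_iff_isLittleO_nhds_zero]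
  have ho := hO.trans_isLittleO (isLittleO_pow_id one_lt_two)
  simpa [h0, mul_div_assoc] using ho

end
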